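/- arXiv:2407.10350 — 2 statements merged into one kernel-verified Lean document; each statement's English description precedes it below -/
import Mathlib

section
/- Let (t_k)_{k≥0} satisfy condition (T), let 0 < s < 1/L, and let (x_k), (y_k) be generated by (TIREPROG). Let k₀ ∈ ℕ be such that s ≤ 1/(L + ε_{k₀}). Assume that liminf_{k→∞} (−t_k² + t_k + t_{k−1}²)/t_k > 0, that the sequence (t_k² ε_k)_{k≥k₀−1} is increasing, that lim_{k→∞} t_k² ε_k = +∞, and that lim_{k→∞} t_k(ε_k − ε_{k+1})/ε_k = 0. Then: (F_k(x_k) − F_k(x̄_k))/ε_k → 0 as k → +∞; there exists C > 0 and K ∈ ℕ such that (f+g)(x_k) − min(f+g) ≤ C ε_k for all k ≥ K; and ‖x_k − x_{k−1}‖/√ε_k → 0 as k → +∞. -/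
open Filter Topology
open scoped RealInnerProductSpace

/-- A nonnegative sequence contracted at a non-summable rate, up to vanishing errors, tends to `0`. -/
theorem tendsto_zero_of_contraction_harmonic {a κ δ : ℕ → ℝ} {q : ℝ} (hq : 0 < q)
    (ha : ∀ᶠ n in atTop, 0 ≤ a n) (hκ : ∀ᶠ n in atTop, q / (n + 1) ≤ κ n)
    (hκ1 : ∀ᶠ n in atTop, κ n ≤ 1) (hδ : Tendsto δ atTop (𝓝 0))
    (hrec : ∀ᶠ n in atTop, a (n + 1) ≤ (1 - κ n) * a n + κ n * δ n) :
    Tendsto a atTop (𝓝 0) := by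
  refine tendsto_order.2 ⟨fun e he => ha.mono fun n hn => he.trans_le hn, fun e he => ?_⟩
  obtain ⟨N, hN⟩ := eventually_atTop.1
    (hκ.and (hκ1.and (hrec.and (hδ.eventually (gt_mem_nhds (half_pos he))))))
  set M := max (a N - e / 2) 0 with hM
  have hM0 : 0 ≤ M := le_max_right _ _
  have key : ∀ m : ℕ, a (N + m) - e / 2 ≤
      Real.exp (-∑ i ∈ Finset.range m, κ (N + i)) * M := by
    intro m
    induction m with
    | zero => simp [hM]
    | succ m ih =>
      obtain ⟨h0, h1, h2, h3⟩ := hN (N + m) (by omega)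
      have hk0 : 0 ≤ κ (N + m) := le_trans (by positivity) h0
      rw [Finset.sum_range_succ, neg_add, Real.exp_add]
      have h4 : 1 - κ (N + m) ≤ Real.exp (-κ (N + m)) := Real.one_sub_le_exp_neg _
      have h5 : a (N + (m + 1)) - e / 2 ≤ (1 - κ (N + m)) * (a (N + m) - e / 2) := by
        have := mul_le_mul_of_nonneg_left h3.le hk0
        rw [← add_assoc]; linarith
      calc _ ≤ _ := h5
        _ ≤ (1 - κ (N + m)) * (Real.exp (-∑ i ∈ Finset.range m, κ (N + i)) * M) :=
          mul_le_mul_of_nonneg_left ih (by linarith)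
        _ ≤ Real.exp (-κ (N + m)) * (Real.exp (-∑ i ∈ Finset.range m, κ (N + i)) * M) :=
          mul_le_mul_of_nonneg_right h4 (by positivity)
        _ = _ := by ring
  have hsum : Tendsto (fun m => ∑ i ∈ Finset.range m, κ (N + i)) atTop atTop := by
    have hH := Real.tendsto_sum_range_one_div_nat_succ_atTop
    have hH2 := tendsto_atTop_add_const_right atTop
      (-(q * ∑ i ∈ Finset.range N, 1 / ((i : ℝ) + 1)))
      ((((tendsto_add_atTop_iff_nat N).2 hH)).const_mul_atTop hq)
    refine tendsto_atTop_mono (fun m => ?_) hH2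
    rw [add_comm m N, Finset.sum_range_add, mul_add, add_neg_cancel_comm, Finset.mul_sum]
    refine Finset.sum_le_sum fun i _ => ?_
    have := (hN (N + i) (by omega)).1
    rwa [mul_one_div]
  have hlim : Tendsto (fun m => Real.exp (-∑ i ∈ Finset.range m, κ (N + i)) * M) atTop (𝓝 0) := by
    simpa using (Real.tendsto_exp_neg_atTop_nhds_zero.comp hsum).mul_const M
  have := hlim.eventually (gt_mem_nhds (half_pos he))
  obtain ⟨m0, hm0⟩ := eventually_atTop.1 this
  refine eventually_atTop.2 ⟨N + m0, fun n hn => ?_⟩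
  obtain ⟨m, rfl⟩ := Nat.exists_eq_add_of_le (show N ≤ n by omega)
  have := key m
  have := hm0 m (by omega)
  linarith

theorem inertial_sequence_bounds {t : ℕ → ℝ} (ht0 : t 0 = 1)
    (hT : ∀ k : ℕ, 1 ≤ k →
      t (k - 1) < t k ∧ t k < (1 + Real.sqrt (1 + 4 * t (k - 1) ^ 2)) / 2) (n : ℕ) :
    1 ≤ t n ∧ t n ≤ n + 1 ∧ t n < t (n + 1) ∧
      0 < -t (n + 1) ^ 2 + t (n + 1) + t n ^ 2 := by
  have hlt : ∀ n, t n < t (n + 1) := fun n => (hT (n + 1) (by omega)).1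
  have hub : ∀ n, 2 * t (n + 1) - 1 < √(1 + 4 * t n ^ 2) := fun n => by
    have := (hT (n + 1) (by omega)).2
    rw [Nat.add_sub_cancel] at this
    linarith
  have h1 : ∀ n, 1 ≤ t n := fun n => ht0 ▸ (strictMono_nat_of_lt_succ hlt).monotone n.zero_le
  refine ⟨h1 n, ?_, hlt n, ?_⟩
  · induction n with
    | zero => simp [ht0]
    | succ n ih =>
      have h2 : √(1 + 4 * t n ^ 2) ≤ 1 + 2 * t n :=
        Real.sqrt_le_iff.2 ⟨by linarith [h1 n], by linarith [h1 n]⟩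
      push_cast
      linarith [hub n]
  · have h2 := (Real.lt_sqrt (by linarith [h1 (n + 1)])).1 (hub n)
    linarith

section Convex

variable {H : Type*} [NormedAddCommGroup H] [InnerProductSpace ℝ H]

theorem norm_sq_convex_combination (a b : ℝ) (hab : a + b = 1) (u v : H) :
    ‖a • u + b • v‖ ^ 2 = a * ‖u‖ ^ 2 + b * ‖v‖ ^ 2 - a * b * ‖u - v‖ ^ 2 := by
  obtain rfl : a = 1 - b := by linarith
  rw [norm_add_sq_real, norm_sub_sq_real, norm_smul, norm_smul, inner_smul_left, inner_smul_right,
    mul_pow, mul_pow, Real.norm_eq_abs, Real.norm_eq_abs, sq_abs, sq_abs]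
  simp only [conj_trivial]
  ring

/-- Quadratic growth at a minimizer of a convex function plus a squared distance. -/
theorem ConvexOn.quadratic_growth {D : Set H} {φ : H → ℝ} (hφ : ConvexOn ℝ D φ) {c : ℝ} {z p u : H}
    (hp : p ∈ D) (hu : u ∈ D)
    (hmin : ∀ w ∈ D, φ p + c * ‖p - z‖ ^ 2 ≤ φ w + c * ‖w - z‖ ^ 2) :
    φ p + c * ‖p - z‖ ^ 2 + c * ‖u - p‖ ^ 2 ≤ φ u + c * ‖u - z‖ ^ 2 := by
  have key : ∀ l ∈ Set.Ioo (0 : ℝ) 1,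
      φ p + c * ‖p - z‖ ^ 2 + (1 - l) * (c * ‖u - p‖ ^ 2) ≤ φ u + c * ‖u - z‖ ^ 2 := by
    rintro l ⟨hl0, hl1⟩
    have h1 := hmin _ (hφ.1 hp hu (sub_nonneg.2 hl1.le) hl0.le (by ring))
    have h2 := hφ.2 hp hu (sub_nonneg.2 hl1.le) hl0.le (by ring)
    have h3 : (1 - l) • p + l • u - z = (1 - l) • (p - z) + l • (u - z) := by module
    rw [h3, norm_sq_convex_combination _ _ (by ring), sub_sub_sub_cancel_right,
      norm_sub_rev p u] at h1
    simp only [smul_eq_mul] at h2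
    refine le_of_mul_le_mul_left ?_ hl0
    nlinarith
  have hlim : Tendsto (fun l : ℝ => φ p + c * ‖p - z‖ ^ 2 + (1 - l) * (c * ‖u - p‖ ^ 2))
      (𝓝[>] 0) (𝓝 (φ p + c * ‖p - z‖ ^ 2 + (1 - 0) * (c * ‖u - p‖ ^ 2))) :=
    (Continuous.tendsto (by fun_prop) 0).mono_left nhdsWithin_le_nhds
  have := le_of_tendsto hlim
    (Filter.mem_of_superset (Ioo_mem_nhdsGT one_pos) key)
  simpa using this

/-- The minimizers of Tikhonov regularizations depend on the parameter in a Lipschitz way. -/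
theorem ConvexOn.tikhonov_minimizer_dist {D : Set H} {φ : H → ℝ} (hφ : ConvexOn ℝ D φ)
    {e e' R : ℝ} {b b' : H} (he : 0 < e) (he' : 0 ≤ e') (hee : e' ≤ e) (hb : b ∈ D) (hb' : b' ∈ D)
    (hbR : ‖b‖ ≤ R) (hbR' : ‖b'‖ ≤ R)
    (hmin : ∀ w ∈ D, φ b + e / 2 * ‖b‖ ^ 2 ≤ φ w + e / 2 * ‖w‖ ^ 2)
    (hmin' : ∀ w ∈ D, φ b' + e' / 2 * ‖b'‖ ^ 2 ≤ φ w + e' / 2 * ‖w‖ ^ 2) :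
    ‖b' - b‖ ≤ 2 * R * ((e - e') / e) := by
  have h1 := hφ.quadratic_growth (z := 0) hb hb' (by simpa using hmin)
  have h2 := hφ.quadratic_growth (z := 0) hb' hb (by simpa using hmin')
  rw [norm_sub_rev b b'] at h2
  simp only [sub_zero] at h1 h2
  set d := ‖b' - b‖
  have hd : 0 ≤ d := norm_nonneg _
  have h3 : ‖b'‖ ^ 2 - ‖b‖ ^ 2 ≤ 2 * R * d := by
    have h4 : ‖b'‖ - ‖b‖ ≤ d := norm_sub_norm_le _ _
    nlinarith [norm_nonneg b, norm_nonneg b', mul_le_mul_of_nonneg_right h4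
      (add_nonneg (norm_nonneg b') (norm_nonneg b)),
      mul_le_mul_of_nonneg_left (add_le_add hbR' hbR) hd]
  have h5 : e * d ^ 2 ≤ (e - e') * (2 * R * d) := by
    nlinarith [mul_le_mul_of_nonneg_left h3 (sub_nonneg.2 hee), mul_nonneg he' (sq_nonneg d)]
  rcases hd.eq_or_lt with h0 | h0
  · rw [← h0]
    have : 0 ≤ R := (norm_nonneg b).trans hbR
    have := sub_nonneg.2 hee
    positivity
  · rw [← mul_div_assoc, le_div_iff₀ he]
    refine le_of_mul_le_mul_right ?_ h0
    linarith

/-- One step of the inertial scheme, for an arbitrary reference point `z`. -/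
theorem inertial_step {D : Set H} {φ : H → ℝ} (hφ : ConvexOn ℝ D φ) {e c t τ κ : ℝ}
    {x' x y p z : H} (he : 0 ≤ e) (hc : 0 ≤ c) (ht : 1 ≤ t) (hτ : 0 < τ)
    (hκ : κ = (-t ^ 2 + t + τ ^ 2) / τ ^ 2) (hκ0 : 0 ≤ κ) (hx : x ∈ D) (hz : z ∈ D)
    (hy : y = x + (((t - 1) * (τ - 1)) / τ ^ 2) • (x - x')
      - ((-t ^ 2 + t + τ ^ 2) / (τ ^ 2 * t)) • x)
    (hstep : ∀ u ∈ D, φ p + e / 2 * ‖p‖ ^ 2 + c * ‖p - u‖ ^ 2 ≤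
      φ u + e / 2 * ‖u‖ ^ 2 + c * ‖y - u‖ ^ 2) :
    t ^ 2 * (φ p + e / 2 * ‖p‖ ^ 2 - (φ z + e / 2 * ‖z‖ ^ 2))
        + c * ‖t • p - (t - 1) • x - z‖ ^ 2 ≤
      (1 - κ) * (τ ^ 2 * (φ x + e / 2 * ‖x‖ ^ 2 - (φ z + e / 2 * ‖z‖ ^ 2))
        + c * ‖τ • x - (τ - 1) • x' - z‖ ^ 2) + c * κ * ‖z‖ ^ 2 := by
  have ht0 : 0 < t := by linarith
  have hκ' : κ * τ ^ 2 = -t ^ 2 + t + τ ^ 2 := by rw [hκ]; field_simp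
  have hκ1 : 0 ≤ 1 - κ := by
    have : (1 - κ) * τ ^ 2 = t * (t - 1) := by linarith
    exact nonneg_of_mul_nonneg_left (this ▸ mul_nonneg ht0.le (by linarith)) (by positivity)
  have ha : 0 ≤ 1 - 1 / t := by rw [sub_nonneg, div_le_one ht0]; exact ht
  have hb : 0 ≤ 1 / t := by positivity
  set u := (1 - 1 / t) • x + (1 / t) • z with hu
  have hφu := hφ.2 hx hz ha hb (by ring)
  have hnu := norm_sq_convex_combination (1 - 1 / t) (1 / t) (by ring) x z
  have h := hstep u (hφ.1 hx hz ha hb (by ring))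
  have h1 : t • p - (t - 1) • x - z = t • (p - u) := by
    rw [hu]; match_scalars <;> field_simp
  have h2 : (1 - κ) • (τ • x - (τ - 1) • x' - z) + κ • (-z) = t • (y - u) := by
    rw [hu, hy, hκ]; match_scalars <;> field_simp <;> ring
  have h3 := norm_sq_convex_combination (1 - κ) κ (by ring) (τ • x - (τ - 1) • x' - z) (-z)
  rw [h2, norm_smul, mul_pow, Real.norm_eq_abs, sq_abs, norm_neg] at h3
  rw [h1, norm_smul, mul_pow, Real.norm_eq_abs, sq_abs]
  rw [← hu] at hφu hnu
  simp only [smul_eq_mul] at hφu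
  have h4 : 0 ≤ (1 - κ) * κ * ‖τ • x - (τ - 1) • x' - z - -z‖ ^ 2 := by positivity
  have h5 : 0 ≤ (1 - 1 / t) * (1 / t) * ‖x - z‖ ^ 2 := by positivity
  have h6 : φ p + e / 2 * ‖p‖ ^ 2 + c * ‖p - u‖ ^ 2 ≤
      (1 - 1 / t) * (φ x + e / 2 * ‖x‖ ^ 2) + 1 / t * (φ z + e / 2 * ‖z‖ ^ 2)
        + c * ‖y - u‖ ^ 2 := by
    nlinarith [mul_nonneg he h5]
  have h7 := mul_le_mul_of_nonneg_left h6 (sq_nonneg t)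
  have h8 : t ^ 2 * ((1 - 1 / t) * (φ x + e / 2 * ‖x‖ ^ 2) + 1 / t * (φ z + e / 2 * ‖z‖ ^ 2)
        + c * ‖y - u‖ ^ 2) = (t ^ 2 - t) * (φ x + e / 2 * ‖x‖ ^ 2)
        + t * (φ z + e / 2 * ‖z‖ ^ 2) + c * (t ^ 2 * ‖y - u‖ ^ 2) := by
    field_simp
  have h9 : t ^ 2 - t = (1 - κ) * τ ^ 2 := by linarith
  have h10 := mul_le_mul_of_nonneg_left
    (h3.le.trans (sub_le_self _ h4)) hc
  rw [h8] at h7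
  have h11 : (1 - κ) * τ ^ 2 * (φ x + e / 2 * ‖x‖ ^ 2 - (φ z + e / 2 * ‖z‖ ^ 2)) =
    (t ^ 2 - t) * (φ x + e / 2 * ‖x‖ ^ 2 - (φ z + e / 2 * ‖z‖ ^ 2)) := by rw [h9]
  linarith

/-- The energy of the scheme contracts, up to errors, when the regularization decreases. -/
theorem inertial_energy_le {D : Set H} {φ : H → ℝ} (hφ : ConvexOn ℝ D φ)
    {e e' c t τ κ q R : ℝ} {x' x y p b b' : H}
    (he : 0 < e) (he' : 0 ≤ e') (hee : e' ≤ e) (hc : 0 ≤ c) (ht : 1 ≤ t) (hτ : 0 < τ)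
    (hκ : κ = (-t ^ 2 + t + τ ^ 2) / τ ^ 2) (hq : 0 < q) (hqκ : q / τ ≤ κ) (hκ1 : κ ≤ 1)
    (hx : x ∈ D) (hb : b ∈ D) (hb' : b' ∈ D) (hbR : ‖b‖ ≤ R) (hbR' : ‖b'‖ ≤ R)
    (hmin : ∀ w ∈ D, φ b + e / 2 * ‖b‖ ^ 2 ≤ φ w + e / 2 * ‖w‖ ^ 2)
    (hmin' : ∀ w ∈ D, φ b' + e' / 2 * ‖b'‖ ^ 2 ≤ φ w + e' / 2 * ‖w‖ ^ 2)
    (hy : y = x + (((t - 1) * (τ - 1)) / τ ^ 2) • (x - x')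
      - ((-t ^ 2 + t + τ ^ 2) / (τ ^ 2 * t)) • x)
    (hstep : ∀ u ∈ D, φ p + e' / 2 * ‖p‖ ^ 2 + c * ‖p - u‖ ^ 2 ≤
      φ u + e' / 2 * ‖u‖ ^ 2 + c * ‖y - u‖ ^ 2) :
    t ^ 2 * (φ p + e' / 2 * ‖p‖ ^ 2 - (φ b' + e' / 2 * ‖b'‖ ^ 2))
        + c * ‖t • p - (t - 1) • x - b'‖ ^ 2 ≤
      (1 - κ / 2) * (τ ^ 2 * (φ x + e / 2 * ‖x‖ ^ 2 - (φ b + e / 2 * ‖b‖ ^ 2))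
        + c * ‖τ • x - (τ - 1) • x' - b‖ ^ 2)
      + κ * (τ ^ 2 * e * (R ^ 2 / (2 * q) * (τ * (e - e') / e))
        + (8 * c * R ^ 2 / q ^ 2 * (τ * (e - e') / e) ^ 2 + c * R ^ 2)) := by
  have hκ0 : 0 < κ := lt_of_lt_of_le (by positivity) hqκ
  have hR : 0 ≤ R := (norm_nonneg b).trans hbR
  have hΔ := sub_nonneg.2 hee
  have h := inertial_step hφ he' hc ht hτ hκ hκ0.le hx hb' hy hstep
  have hd := hφ.tikhonov_minimizer_dist he he' hee hb hb' hbR hbR' hmin hmin'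
  set ρ := τ * (e - e') / e with hρ
  set W := φ x + e / 2 * ‖x‖ ^ 2 - (φ b + e / 2 * ‖b‖ ^ 2) with hW
  have hW0 : 0 ≤ W := sub_nonneg.2 (hmin x hx)
  set v := τ • x - (τ - 1) • x'
  have hρ0 : 0 ≤ ρ := by positivity
  have hΔκ : (e - e') / e ≤ ρ * κ / q := by
    rw [div_le_iff₀ hτ] at hqκ
    rw [hρ, div_mul_eq_mul_div, div_div, div_le_div_iff₀ he (by positivity)]
    have := mul_le_mul_of_nonneg_left hqκ (mul_nonneg hΔ he.le)
    linarith
  have hbsq : ‖b'‖ ^ 2 ≤ R ^ 2 := pow_le_pow_left₀ (norm_nonneg _) hbR' 2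
  have hval : φ x + e' / 2 * ‖x‖ ^ 2 - (φ b' + e' / 2 * ‖b'‖ ^ 2) ≤ W + (e - e') / 2 * R ^ 2 := by
    have h1 := hmin b' hb'
    have h2 := mul_le_mul_of_nonneg_left hbsq hΔ
    have h3 := mul_nonneg hΔ (sq_nonneg ‖x‖)
    rw [hW]
    linarith
  have hd0 : 0 ≤ ‖b' - b‖ := norm_nonneg _
  have hdκ : ‖b' - b‖ ≤ κ * (2 * R * ρ / q) := by
    refine hd.trans ((mul_le_mul_of_nonneg_left hΔκ (by positivity)).trans_eq ?_)
    ring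
  have hdsq : ‖b' - b‖ ^ 2 ≤ κ ^ 2 * (4 * R ^ 2 / q ^ 2 * ρ ^ 2) := by
    refine (pow_le_pow_left₀ hd0 hdκ 2).trans_eq ?_
    ring
  have hv : (1 - κ) * ‖v - b'‖ ^ 2 ≤
      (1 - κ / 2) * ‖v - b‖ ^ 2 + κ * (2 * (4 * R ^ 2 / q ^ 2 * ρ ^ 2)) := by
    generalize 4 * R ^ 2 / q ^ 2 * ρ ^ 2 = Z at hdsq ⊢
    have h1 : ‖v - b'‖ ≤ ‖v - b‖ + ‖b' - b‖ := by
      rw [norm_sub_rev b' b]; exact norm_sub_le_norm_sub_add_norm_sub v b b'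
    have h2 : κ * ‖v - b'‖ ^ 2 ≤
        κ * (1 + κ / 2) * ‖v - b‖ ^ 2 + (κ + 2) * ‖b' - b‖ ^ 2 := by
      have := mul_le_mul_of_nonneg_left (pow_le_pow_left₀ (norm_nonneg _) h1 2) hκ0.le
      linarith [sq_nonneg (κ * ‖v - b‖ - 2 * ‖b' - b‖)]
    have h3 := mul_le_mul_of_nonneg_left h2 (sub_nonneg.2 hκ1)
    have h4 : (1 - κ) * (κ + 2) * ‖b' - b‖ ^ 2 ≤ 2 * ‖b' - b‖ ^ 2 :=
      mul_le_mul_of_nonneg_right (by linarith only [hκ0, sq_nonneg κ]) (sq_nonneg _)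
    have h5 : (1 - κ) * (1 + κ / 2) * ‖v - b‖ ^ 2 ≤ (1 - κ / 2) * ‖v - b‖ ^ 2 :=
      mul_le_mul_of_nonneg_right (by linarith only [hκ0, sq_nonneg κ]) (sq_nonneg _)
    have h6 := mul_le_mul_of_nonneg_left h5 hκ0.le
    refine le_of_mul_le_mul_left ?_ hκ0
    linarith
  have hval' : (1 - κ) * (τ ^ 2 * (φ x + e' / 2 * ‖x‖ ^ 2 - (φ b' + e' / 2 * ‖b'‖ ^ 2))) ≤
      (1 - κ / 2) * (τ ^ 2 * W) + κ * (τ ^ 2 * e * (R ^ 2 / (2 * q) * ρ)) := by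
    have h1 := mul_le_mul_of_nonneg_left hval
      (mul_nonneg (sub_nonneg.2 hκ1) (sq_nonneg τ))
    have h2 : 0 ≤ κ * (τ ^ 2 * W) := by positivity
    have h3 : 0 ≤ κ * (τ ^ 2 * ((e - e') / 2 * R ^ 2)) := by positivity
    have h4 := mul_le_mul_of_nonneg_left hΔκ (show 0 ≤ τ ^ 2 * e * (R ^ 2 / 2) by positivity)
    have h5 : τ ^ 2 * e * (R ^ 2 / 2) * ((e - e') / e) = τ ^ 2 * ((e - e') / 2 * R ^ 2) := by
      field_simp
    have h6 : τ ^ 2 * e * (R ^ 2 / 2) * (ρ * κ / q) =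
        κ * (τ ^ 2 * e * (R ^ 2 / (2 * q) * ρ)) := by
      field_simp
    linarith
  have hcv := mul_le_mul_of_nonneg_left hv hc
  have hcb := mul_le_mul_of_nonneg_left hbsq (mul_nonneg hc hκ0.le)
  calc _ ≤ _ := h
    _ ≤ _ := by
      have : c * (κ * (2 * (4 * R ^ 2 / q ^ 2 * ρ ^ 2))) = κ * (8 * c * R ^ 2 / q ^ 2 * ρ ^ 2) := by
        ring
      linarith

theorem inertial_rates_of_step {D : Set H} {φ : H → ℝ} (hφ : ConvexOn ℝ D φ)
    {t ε : ℕ → ℝ} {x y b : ℕ → H} {c q R : ℝ} (hc : 0 < c) (hq : 0 < q)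
    (ht : ∀ n : ℕ, 1 ≤ t n ∧ t n ≤ n + 1 ∧ t n < t (n + 1) ∧
      0 < -t (n + 1) ^ 2 + t (n + 1) + t n ^ 2)
    (hqt : ∀ᶠ n in atTop, q < (-t (n + 1) ^ 2 + t (n + 1) + t n ^ 2) / t (n + 1))
    (hε : ∀ᶠ n in atTop, 0 < ε n) (hanti : ∀ᶠ n in atTop, ε (n + 1) ≤ ε n)
    (hP : ∀ᶠ n in atTop, t n ^ 2 * ε n ≤ t (n + 1) ^ 2 * ε (n + 1))
    (hPtop : Tendsto (fun n => t n ^ 2 * ε n) atTop atTop)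
    (hρ : Tendsto (fun n => t n * (ε n - ε (n + 1)) / ε n) atTop (𝓝 0))
    (hx : ∀ᶠ n in atTop, x n ∈ D) (hb : ∀ᶠ n in atTop, b n ∈ D)
    (hbR : ∀ᶠ n in atTop, ‖b n‖ ≤ R)
    (hmin : ∀ᶠ n in atTop, ∀ w ∈ D, φ (b n) + ε n / 2 * ‖b n‖ ^ 2 ≤ φ w + ε n / 2 * ‖w‖ ^ 2)
    (hy : ∀ᶠ n in atTop, y (n + 1) = x (n + 1)
      + (((t (n + 1) - 1) * (t n - 1)) / t n ^ 2) • (x (n + 1) - x n)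
      - ((-t (n + 1) ^ 2 + t (n + 1) + t n ^ 2) / (t n ^ 2 * t (n + 1))) • x (n + 1))
    (hstep : ∀ᶠ n in atTop, ∀ u ∈ D,
      φ (x (n + 1)) + ε n / 2 * ‖x (n + 1)‖ ^ 2 + c * ‖x (n + 1) - u‖ ^ 2 ≤
        φ u + ε n / 2 * ‖u‖ ^ 2 + c * ‖y n - u‖ ^ 2) :
    Tendsto (fun n => (φ (x n) + ε n / 2 * ‖x n‖ ^ 2 - (φ (b n) + ε n / 2 * ‖b n‖ ^ 2)) / ε n)
      atTop (𝓝 0) ∧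
    Tendsto (fun n => ‖x n - x (n - 1)‖ / √(ε n)) atTop (𝓝 0) := by
  set κ : ℕ → ℝ := fun n => (-t (n + 1) ^ 2 + t (n + 1) + t n ^ 2) / t n ^ 2 with hκdef
  set ρ : ℕ → ℝ := fun n => t n * (ε n - ε (n + 1)) / ε n with hρdef
  set P : ℕ → ℝ := fun n => t n ^ 2 * ε n with hPdef
  set E : ℕ → ℝ := fun n => t n ^ 2 * (φ (x (n + 1)) + ε n / 2 * ‖x (n + 1)‖ ^ 2
    - (φ (b n) + ε n / 2 * ‖b n‖ ^ 2))
    + c * ‖t n • x (n + 1) - (t n - 1) • x n - b n‖ ^ 2 with hEdef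
  have nxt : ∀ {p : ℕ → Prop}, (∀ᶠ n in atTop, p n) → ∀ᶠ n in atTop, p (n + 1) :=
    fun h => (tendsto_add_atTop_nat 1).eventually h
  have ht0 : ∀ n, 0 < t n := fun n => by linarith [(ht n).1]
  have hPpos : ∀ᶠ n in atTop, 0 < P n := hε.mono fun n hn => by
    have := ht0 n
    positivity
  have hgap : ∀ᶠ n in atTop,
      0 ≤ φ (x (n + 1)) + ε n / 2 * ‖x (n + 1)‖ ^ 2 - (φ (b n) + ε n / 2 * ‖b n‖ ^ 2) := by
    filter_upwards [nxt hx, hmin] with n h1 h2 using sub_nonneg.2 (h2 _ h1)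
  have hE0 : ∀ᶠ n in atTop, 0 ≤ E n := by
    filter_upwards [hgap] with n h1
    exact add_nonneg (mul_nonneg (sq_nonneg _) h1) (by positivity)
  have hqκ : ∀ᶠ n in atTop, q / t n ≤ κ n := by
    filter_upwards [hqt] with n h1
    obtain ⟨-, -, h2, -⟩ := ht n
    have h3 := ht0 n
    rw [lt_div_iff₀ (h3.trans h2)] at h1
    rw [hκdef, div_le_div_iff₀ h3 (by positivity)]
    nlinarith [mul_lt_mul_of_pos_left h2 hq]
  have hκ1 : ∀ n, κ n ≤ 1 := fun n => by
    obtain ⟨h1, -, h2, -⟩ := ht n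
    have h3 := ht0 n
    rw [hκdef, div_le_one (by positivity)]
    nlinarith
  have hPinv : Tendsto (fun n => (P n)⁻¹) atTop (𝓝 0) := tendsto_inv_atTop_zero.comp hPtop
  have hδ : Tendsto (fun n => 2 * (R ^ 2 / (2 * q) * ρ n
      + (8 * c * R ^ 2 / q ^ 2 * ρ n ^ 2 + c * R ^ 2) * (P n)⁻¹)) atTop (𝓝 0) := by
    have h1 := ((hρ.const_mul (R ^ 2 / (2 * q))).add
      ((((hρ.pow 2).const_mul (8 * c * R ^ 2 / q ^ 2)).add_const (c * R ^ 2)).mul hPinv)).const_mul 2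
    simpa using h1
  have ha : Tendsto (fun n => E n / P n) atTop (𝓝 0) := by
    refine tendsto_zero_of_contraction_harmonic (κ := fun n => κ n / 2) (half_pos hq) ?_ ?_
      (Eventually.of_forall fun n => by linarith [hκ1 n]) hδ ?_
    · filter_upwards [hE0, hPpos] with n h1 h2 using div_nonneg h1 h2.le
    · filter_upwards [hqκ] with n h1
      have h2 : q / (n + 1) ≤ q / t n := div_le_div_of_nonneg_left hq.le (ht0 n) (ht n).2.1
      rw [div_right_comm]
      linarith
    · filter_upwards [hE0, nxt hE0, hPpos, hP, hε, nxt hε, hanti, hqκ, nxt hx, hb, nxt hb, hbR,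
        nxt hbR, hmin, nxt hmin, hy, nxt hstep] with n hE hE' hP0 hPP he he' hee hqn hxn hbn hbn'
        hR hR' hm hm' hyn hst
      have h := inertial_energy_le hφ he he'.le hee hc.le (ht (n + 1)).1 (ht0 n) rfl hq hqn (hκ1 n)
        hxn hbn hbn' hR hR' hm hm' hyn hst
      calc E (n + 1) / P (n + 1) ≤ E (n + 1) / P n := div_le_div_of_nonneg_left hE' hP0 hPP
        _ ≤ ((1 - κ n / 2) * E n + κ n * (P n * (R ^ 2 / (2 * q) * ρ n)
            + (8 * c * R ^ 2 / q ^ 2 * ρ n ^ 2 + c * R ^ 2))) / P n :=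
          div_le_div_of_nonneg_right h hP0.le
        _ = _ := by field_simp
  have hhalf : ∀ᶠ n in atTop, ε n ≤ 2 * ε (n + 1) := by
    filter_upwards [hρ.eventually (gt_mem_nhds (half_pos one_pos)), hε, hanti] with n h1 h2 h3
    rw [hρdef, div_lt_iff₀ h2] at h1
    nlinarith [mul_le_mul_of_nonneg_right (ht n).1 (sub_nonneg.2 h3)]
  have hval : Tendsto
      (fun n => (φ (x n) + ε n / 2 * ‖x n‖ ^ 2 - (φ (b n) + ε n / 2 * ‖b n‖ ^ 2)) / ε n)
      atTop (𝓝 0) := by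
    rw [← tendsto_add_atTop_iff_nat 1]
    have hlim : Tendsto (fun n => 2 * (E n / P n + R ^ 2 / 2 * ρ n)) atTop (𝓝 0) := by
      simpa using (ha.add (hρ.const_mul (R ^ 2 / 2))).const_mul 2
    refine squeeze_zero' ?_ ?_ hlim
    · filter_upwards [nxt hx, nxt hmin, nxt hε] with n h1 h2 h3
      exact div_nonneg (sub_nonneg.2 (h2 _ h1)) h3.le
    · filter_upwards [nxt hb, nxt hbR, hmin, hε, nxt hε, hanti, hhalf, hgap] with n hbn hR hm he he'
        hee hh hg
      have h1 := hm _ hbn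
      have h2 : ‖b (n + 1)‖ ^ 2 ≤ R ^ 2 := pow_le_pow_left₀ (norm_nonneg _) hR 2
      have h3 := mul_le_mul_of_nonneg_left h2 (sub_nonneg.2 hee)
      have h4 := mul_nonneg (sub_nonneg.2 hee) (sq_nonneg ‖x (n + 1)‖)
      have htn := ht0 n
      have h5 : φ (x (n + 1)) + ε n / 2 * ‖x (n + 1)‖ ^ 2 - (φ (b n) + ε n / 2 * ‖b n‖ ^ 2)
          ≤ E n / P n * ε n := by
        have : E n / P n * ε n = E n / t n ^ 2 := by
          rw [hPdef]; field_simp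
        rw [this, le_div_iff₀ (by positivity), hEdef, mul_comm]
        have : 0 ≤ c * ‖t n • x (n + 1) - (t n - 1) • x n - b n‖ ^ 2 := by positivity
        linarith
      have h6 : ε n - ε (n + 1) ≤ ρ n * ε n := by
        have : ρ n * ε n = t n * (ε n - ε (n + 1)) := by rw [hρdef]; field_simp
        rw [this]
        nlinarith [mul_le_mul_of_nonneg_right (ht n).1 (sub_nonneg.2 hee)]
      have h7 := mul_le_mul_of_nonneg_right h6 (sq_nonneg R)
      have h8 : φ (x (n + 1)) + ε (n + 1) / 2 * ‖x (n + 1)‖ ^ 2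
          - (φ (b (n + 1)) + ε (n + 1) / 2 * ‖b (n + 1)‖ ^ 2) ≤
          (E n / P n + R ^ 2 / 2 * ρ n) * ε n := by linarith
      have h9 : 0 ≤ E n / P n + R ^ 2 / 2 * ρ n := by
        have h10 : 0 ≤ E n / P n := nonneg_of_mul_nonneg_left (hg.trans h5) he
        have h11 : 0 ≤ ρ n := div_nonneg (mul_nonneg htn.le (sub_nonneg.2 hee)) he.le
        positivity
      rw [div_le_iff₀ he']
      linarith [mul_le_mul_of_nonneg_left hh h9]
  refine ⟨hval, ?_⟩
  rw [← tendsto_add_atTop_iff_nat 1]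
  set W : ℕ → ℝ :=
    fun n => (φ (x n) + ε n / 2 * ‖x n‖ ^ 2 - (φ (b n) + ε n / 2 * ‖b n‖ ^ 2)) / ε n with hW
  have hlim : Tendsto (fun n => √(4 / c * (E n / P n) + 8 * (W n * (P n)⁻¹))) atTop (𝓝 0) := by
    have := ((ha.const_mul (4 / c)).add ((hval.mul hPinv).const_mul 8)).sqrt
    simpa using this
  refine squeeze_zero' (Eventually.of_forall fun n => by positivity) ?_ hlim
  filter_upwards [hx, hb, hmin, hε, nxt hε, hhalf, hgap, hPpos] with n hxn hbn hm he he' hh hg hP0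
  have htn := ht0 n
  refine Real.le_sqrt_of_sq_le ?_
  rw [Nat.add_sub_cancel, div_pow, Real.sq_sqrt he'.le, div_le_iff₀ he']
  set v := t n • x (n + 1) - (t n - 1) • x n
  have hv : c * ‖v - b n‖ ^ 2 ≤ E n := by
    rw [hEdef]
    exact le_add_of_nonneg_left (mul_nonneg (sq_nonneg _) hg)
  have hxb : ‖x n - b n‖ ^ 2 ≤ 2 * W n := by
    have h1 := hφ.quadratic_growth (c := ε n / 2) (z := 0) hbn hxn (by simpa using hm)
    simp only [sub_zero] at h1
    have h2 : W n * ε n = φ (x n) + ε n / 2 * ‖x n‖ ^ 2 - (φ (b n) + ε n / 2 * ‖b n‖ ^ 2) := by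
      rw [hW]; field_simp
    refine le_of_mul_le_mul_right ?_ he
    linarith
  have hdiff : t n ^ 2 * ‖x (n + 1) - x n‖ ^ 2 ≤ 2 * ‖v - b n‖ ^ 2 + 2 * ‖x n - b n‖ ^ 2 := by
    have h1 : t n • (x (n + 1) - x n) = (v - b n) - (x n - b n) := by
      simp only [v]; module
    have h2 := parallelogram_law_with_norm ℝ (v - b n) (x n - b n)
    rw [← h1, norm_smul, Real.norm_eq_abs, abs_of_pos htn] at h2
    nlinarith [mul_self_nonneg ‖v - b n + (x n - b n)‖]
  have hv' : ‖v - b n‖ ^ 2 ≤ E n / c := by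
    rw [le_div_iff₀ hc]; linarith
  have h1 : ‖x (n + 1) - x n‖ ^ 2 ≤ (2 / c * (E n / P n) + 4 * (W n * (P n)⁻¹)) * ε n := by
    have : (2 / c * (E n / P n) + 4 * (W n * (P n)⁻¹)) * ε n
        = (2 * (E n / c) + 4 * W n) / t n ^ 2 := by
      rw [hPdef]; field_simp
    rw [this, le_div_iff₀ (by positivity)]
    linarith
  have h2 : 0 ≤ 2 / c * (E n / P n) + 4 * (W n * (P n)⁻¹) :=
    nonneg_of_mul_nonneg_left ((sq_nonneg _).trans h1) he
  calc _ ≤ _ := h1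
    _ ≤ (2 / c * (E n / P n) + 4 * (W n * (P n)⁻¹)) * (2 * ε (n + 1)) :=
      mul_le_mul_of_nonneg_left hh h2
    _ = _ := by ring

variable [CompleteSpace H]

theorem HasGradientAt.hasDerivAt_line {g : H → ℝ} {G y d : H} {r : ℝ}
    (h : HasGradientAt g G (y + r • d)) :
    HasDerivAt (fun r : ℝ => g (y + r • d)) ⟪G, d⟫ r := by
  have h1 : HasDerivAt (fun r : ℝ => y + r • d) d r := by
    simpa using ((hasDerivAt_id r).smul_const d).const_add y
  exact (h.hasFDerivAt.comp_hasDerivAt r h1).congr_deriv (by simp)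

theorem ConvexOn.gradient_inequality {g : H → ℝ} (hg : ConvexOn ℝ Set.univ g) {G y : H}
    (h : HasGradientAt g G y) (u : H) : g y + ⟪G, u - y⟫ ≤ g u := by
  have hd : HasDerivAt (fun r : ℝ => g (y + r • (u - y))) ⟪G, u - y⟫ 0 :=
    HasGradientAt.hasDerivAt_line (by simpa using h)
  have hc : ConvexOn ℝ Set.univ (fun r : ℝ => g (y + r • (u - y))) := by
    have := hg.comp_affineMap (AffineMap.lineMap y u)
    refine this.congr fun r _ => ?_
    simp [AffineMap.lineMap_apply, add_comm]
  have := hc.le_slope_of_hasDerivAt (Set.mem_univ 0) (Set.mem_univ 1) one_pos hd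
  simp [slope_def_field] at this
  linarith

/-- The descent lemma for a function with Lipschitz gradient. -/
theorem le_quadratic_of_lipschitz_gradient {g : H → ℝ} {g' : H → H} {L : ℝ}
    (hg : ∀ u, HasGradientAt g (g' u) u) (hlip : ∀ u v, ‖g' u - g' v‖ ≤ L * ‖u - v‖) (u y : H) :
    g u ≤ g y + ⟪g' y, u - y⟫ + L / 2 * ‖u - y‖ ^ 2 := by
  set d := u - y
  have hder : ∀ r : ℝ, HasDerivAt
      (fun r : ℝ => g (y + r • d) - r * ⟪g' y, d⟫ - L / 2 * ‖d‖ ^ 2 * r ^ 2)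
      (⟪g' (y + r • d), d⟫ - ⟪g' y, d⟫ - L / 2 * ‖d‖ ^ 2 * (2 * r)) r := by
    intro r
    have h1 := (HasGradientAt.hasDerivAt_line (hg (y + r • d)))
    have h2 := (hasDerivAt_id r).mul_const ⟪g' y, d⟫
    have h3 := ((hasDerivAt_pow 2 r).const_mul (L / 2 * ‖d‖ ^ 2))
    exact ((h1.sub h2).sub h3).congr_deriv (by simp)
  have hanti := antitoneOn_of_deriv_nonpos (convex_Icc (0 : ℝ) 1)
    (fun r _ => (hder r).continuousAt.continuousWithinAt)
    (fun r _ => (hder r).differentiableAt.differentiableWithinAt) (fun r hr => by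
      rw [interior_Icc] at hr
      rw [(hder r).deriv, ← inner_sub_left]
      have h1 := real_inner_le_norm (g' (y + r • d) - g' y) d
      have h2 := mul_le_mul_of_nonneg_right (hlip (y + r • d) y) (norm_nonneg d)
      rw [add_sub_cancel_left, norm_smul, Real.norm_eq_abs, abs_of_pos hr.1] at h2
      linarith)
  have := hanti (Set.left_mem_Icc.2 zero_le_one) (Set.right_mem_Icc.2 zero_le_one) zero_le_one
  simp [d] at this
  simp only [d]
  linarith

/-- One proximal gradient step on `φ + g + (e / 2) ‖·‖²`. -/
theorem prox_gradient_step {D : Set H} {φ g : H → ℝ} {g' : H → H} {L s e : ℝ} {y p u : H}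
    (hφ : ConvexOn ℝ D φ) (hg : ConvexOn ℝ Set.univ g) (hgd : ∀ u, HasGradientAt g (g' u) u)
    (hlip : ∀ u v, ‖g' u - g' v‖ ≤ L * ‖u - v‖) (hs : 0 < s) (he : 0 ≤ e) (hsL : s * (L + e) ≤ 1)
    (hp : p ∈ D) (hu : u ∈ D)
    (hmin : ∀ w ∈ D, φ p + ‖p - (y - s • g' y - (s * e) • y)‖ ^ 2 / (2 * s) ≤
      φ w + ‖w - (y - s • g' y - (s * e) • y)‖ ^ 2 / (2 * s)) :
    φ p + g p + e / 2 * ‖p‖ ^ 2 + 1 / (2 * s) * ‖p - u‖ ^ 2 ≤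
      φ u + g u + e / 2 * ‖u‖ ^ 2 + 1 / (2 * s) * ‖y - u‖ ^ 2 := by
  have hgrow := hφ.quadratic_growth (c := 1 / (2 * s)) hp hu
    (z := y - s • g' y - (s * e) • y) (fun w hw => by
      have := hmin w hw
      rwa [div_eq_inv_mul, div_eq_inv_mul _ (2 * s), ← one_div] at this)
  have hexp : ∀ w : H, 1 / (2 * s) * ‖w - (y - s • g' y - (s * e) • y)‖ ^ 2 =
      1 / (2 * s) * ‖w - y‖ ^ 2 + ⟪g' y, w - y⟫ + e * ⟪y, w - y⟫ + s / 2 * ‖g' y + e • y‖ ^ 2 := by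
    intro w
    have : w - (y - s • g' y - (s * e) • y) = (w - y) + s • (g' y + e • y) := by module
    rw [this, norm_add_sq_real, norm_smul, inner_smul_right, inner_add_right, inner_smul_right,
      real_inner_comm, real_inner_comm y, Real.norm_eq_abs, mul_pow, sq_abs]
    field_simp
    ring
  have hsq : ∀ w : H, ‖w‖ ^ 2 = ‖y‖ ^ 2 + 2 * ⟪y, w - y⟫ + ‖w - y‖ ^ 2 := by
    intro w
    rw [← norm_add_sq_real, add_sub_cancel]
  rw [hexp p, hexp u] at hgrow
  have h1 := le_quadratic_of_lipschitz_gradient hgd hlip p y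
  have h2 := hg.gradient_inequality (hgd y) u
  have h3 : (L + e) / 2 * ‖p - y‖ ^ 2 ≤ 1 / (2 * s) * ‖p - y‖ ^ 2 := by
    refine mul_le_mul_of_nonneg_right ?_ (sq_nonneg _)
    rw [div_le_div_iff₀ two_pos (by positivity)]
    linarith
  have h4 : 0 ≤ e / 2 * ‖u - y‖ ^ 2 := by positivity
  rw [hsq p, hsq u, norm_sub_rev p u, norm_sub_rev y u]
  nlinarith

end Convex

theorem tireprog_fast_rates
    {H : Type*} [NormedAddCommGroup H] [InnerProductSpace ℝ H] [CompleteSpace H]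
    (f : H → EReal) (g : H → ℝ) (g' : H → H) (L : ℝ) (hL : 0 < L)
    -- f is proper, convex and lower semicontinuous
    (hf_proper : ∃ z, f z ≠ ⊤) (hf_nebot : ∀ z, f z ≠ ⊥)
    (hf_convex : ∀ u v : H, ∀ a b : ℝ, 0 ≤ a → 0 ≤ b → a + b = 1 →
      f (a • u + b • v) ≤ (a : EReal) * f u + (b : EReal) * f v)
    (hf_lsc : LowerSemicontinuous f)
    -- g is convex, differentiable with L-Lipschitz gradient g'
    (hg_convex : ConvexOn ℝ Set.univ g)
    (hg_diff : ∀ u : H, HasGradientAt g (g' u) u)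
    (hg_lip : ∀ u v : H, ‖g' u - g' v‖ ≤ L * ‖u - v‖)
    -- prox_{σ f} is a minimizer of u ↦ f(u) + ‖u − z‖²/(2σ)
    (prox : ℝ → H → H)
    (hprox : ∀ σ : ℝ, 0 < σ → ∀ z u : H,
      f (prox σ z) + ((‖prox σ z - z‖ ^ 2 / (2 * σ) : ℝ) : EReal)
        ≤ f u + ((‖u - z‖ ^ 2 / (2 * σ) : ℝ) : EReal))
    -- the sequence (t_k) satisfies condition (T)
    (t : ℕ → ℝ) (ht0 : t 0 = 1)
    (hT : ∀ k : ℕ, 1 ≤ k →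
      t (k - 1) < t k ∧ t k < (1 + Real.sqrt (1 + 4 * t (k - 1) ^ 2)) / 2)
    -- (ε_k) is a nonincreasing sequence of positive reals tending to 0
    (ε : ℕ → ℝ) (hε_pos : ∀ k : ℕ, 1 ≤ k → 0 < ε k)
    (hε_anti : ∀ k : ℕ, 1 ≤ k → ε (k + 1) ≤ ε k)
    (hε_lim : Tendsto ε atTop (nhds (0 : ℝ)))
    -- the stepsize
    (s : ℝ) (hs_pos : 0 < s) (hs_lt : s < 1 / L)
    -- the algorithm (TIREPROG)
    (x y : ℕ → H)
    (hy : ∀ k : ℕ, 1 ≤ k → y k = x k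
        + (((t k - 1) * (t (k - 1) - 1)) / (t (k - 1)) ^ 2) • (x k - x (k - 1))
        - (((-(t k) ^ 2 + t k + (t (k - 1)) ^ 2) / ((t (k - 1)) ^ 2 * t k))) • x k)
    (hx : ∀ k : ℕ, 1 ≤ k →
      x (k + 1) = prox s (y k - s • g' (y k) - (s * ε k) • y k))
    -- k₀ with s ≤ 1/(L + ε_{k₀})
    (k₀ : ℕ) (hk₀ : s ≤ 1 / (L + ε k₀))
    -- the hypotheses on the parameters
    (hliminf : 0 < atTop.liminf (fun k : ℕ => (-(t k) ^ 2 + t k + (t (k - 1)) ^ 2) / t k))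
    (hincr : ∀ k : ℕ, k₀ - 1 ≤ k → (t k) ^ 2 * ε k < (t (k + 1)) ^ 2 * ε (k + 1))
    (htε_top : Tendsto (fun k : ℕ => (t k) ^ 2 * ε k) atTop atTop)
    (hratio : Tendsto (fun k : ℕ => t k * (ε k - ε (k + 1)) / ε k) atTop (nhds (0 : ℝ)))
    -- F_k(x) = f(x) + g(x) + (ε_k/2)‖x‖² and its unique minimizer x̄_k
    (F : ℕ → H → EReal)
    (hF : ∀ (k : ℕ) (u : H), F k u = f u + (g u : EReal) + ((ε k / 2 * ‖u‖ ^ 2 : ℝ) : EReal))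
    (xbar : ℕ → H)
    (hxbar : ∀ (k : ℕ) (u : H), F k (xbar k) ≤ F k u)
    -- a (global) minimizer of f + g, so that (f+g)(xmin) = min (f+g)
    (xmin : H)
    (hxmin : ∀ u : H, f xmin + (g xmin : EReal) ≤ f u + (g u : EReal))
 :
    Tendsto (fun k : ℕ => (F k (x k) - F k (xbar k)) / ((ε k : ℝ) : EReal))
      atTop (nhds (0 : EReal)) ∧
    (∃ C : ℝ, 0 < C ∧ ∃ K : ℕ, ∀ k : ℕ, K ≤ k →
      f (x k) + (g (x k) : EReal) ≤ f xmin + (g xmin : EReal) + ((C * ε k : ℝ) : EReal)) ∧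
    Tendsto (fun k : ℕ => ‖x k - x (k - 1)‖ / Real.sqrt (ε k)) atTop (nhds (0 : ℝ)) := by
  set φ : H → ℝ := fun z => (f z).toReal with hφdef
  set D : Set H := {z | f z ≠ ⊤} with hD
  have hcoe : ∀ z ∈ D, f z = (φ z : EReal) := fun z hz =>
    (EReal.coe_toReal hz (hf_nebot z)).symm
  have hφ : ConvexOn ℝ D φ := by
    have hle : ∀ u ∈ D, ∀ v ∈ D, ∀ a b : ℝ, 0 ≤ a → 0 ≤ b → a + b = 1 →
        f (a • u + b • v) ≤ ((a * φ u + b * φ v : ℝ) : EReal) := by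
      intro u hu v hv a b ha hb hab
      have h := hf_convex u v a b ha hb hab
      rw [hcoe u hu, hcoe v hv] at h
      exact_mod_cast h
    have hconv : Convex ℝ D := fun u hu v hv a b ha hb hab =>
      ne_top_of_le_ne_top (EReal.coe_ne_top _) (hle u hu v hv a b ha hb hab)
    refine ⟨hconv, fun u hu v hv a b ha hb hab => ?_⟩
    have h := hle u hu v hv a b ha hb hab
    rw [hcoe _ (hconv hu hv ha hb hab)] at h
    exact_mod_cast h
  have hφg : ConvexOn ℝ D (φ + g) := hφ.add (hg_convex.subset (Set.subset_univ _) hφ.1)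
  obtain ⟨z₀, hz₀⟩ := hf_proper
  have hmem : ∀ (p : H) (r r' : ℝ), f p + (r : EReal) ≤ f z₀ + (r' : EReal) → p ∈ D := by
    intro p r r' h hp
    rw [hp, EReal.top_add_coe, top_le_iff, hcoe z₀ hz₀] at h
    exact EReal.coe_ne_top _ (by exact_mod_cast h)
  have hF' : ∀ k, ∀ u ∈ D, F k u = ((φ u + g u + ε k / 2 * ‖u‖ ^ 2 : ℝ) : EReal) := by
    intro k u hu
    rw [hF, hcoe u hu]
    norm_cast
  have hxD : ∀ k, 2 ≤ k → x k ∈ D := by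
    intro k hk
    obtain ⟨k, rfl⟩ := Nat.exists_eq_add_of_le' hk
    rw [hx (k + 1) (by omega)]
    exact hmem _ _ _ (hprox s hs_pos _ z₀)
  have hbD : ∀ k, xbar k ∈ D := by
    intro k
    have h := hxbar k z₀
    rw [hF, hF, add_assoc, add_assoc] at h
    exact hmem _ _ _ (by exact_mod_cast h)
  have hminD : xmin ∈ D := hmem _ _ _ (hxmin z₀)
  have hbmin : ∀ k, ∀ w ∈ D, φ (xbar k) + g (xbar k) + ε k / 2 * ‖xbar k‖ ^ 2 ≤
      φ w + g w + ε k / 2 * ‖w‖ ^ 2 := by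
    intro k w hw
    have h := hxbar k w
    rw [hF' k _ (hbD k), hF' k _ hw] at h
    exact_mod_cast h
  have hxmin' : ∀ w ∈ D, φ xmin + g xmin ≤ φ w + g w := by
    intro w hw
    have h := hxmin w
    rw [hcoe _ hminD, hcoe _ hw] at h
    exact_mod_cast h
  have hbR : ∀ k, 1 ≤ k → ‖xbar k‖ ≤ ‖xmin‖ := by
    intro k hk
    have h1 := hbmin k xmin hminD
    have h2 := hxmin' _ (hbD k)
    have h3 := hε_pos k hk
    refine le_of_sq_le_sq ?_ (norm_nonneg _)
    refine le_of_mul_le_mul_left ?_ (half_pos h3)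
    linarith
  have ht := inertial_sequence_bounds ht0 hT
  obtain ⟨q, hq, hqt⟩ : ∃ q > 0, ∀ᶠ k : ℕ in atTop,
      q < (-(t k) ^ 2 + t k + (t (k - 1)) ^ 2) / t k := by
    obtain ⟨q, hq, hql⟩ := exists_between hliminf
    refine ⟨q, hq, eventually_lt_of_lt_liminf hql ⟨0, eventually_map.2 ?_⟩⟩
    filter_upwards [eventually_ge_atTop 1] with k hk
    obtain ⟨k, rfl⟩ := Nat.exists_eq_add_of_le' hk
    exact div_nonneg (ht k).2.2.2.le (by linarith [(ht (k + 1)).1])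
  have hsL : ∀ᶠ k in atTop, s * (L + ε k) ≤ 1 := by
    have h1 : Tendsto (fun k => s * (L + ε k)) atTop (𝓝 (s * (L + 0))) :=
      (hε_lim.const_add L).const_mul s
    refine (h1.eventually (gt_mem_nhds ?_)).mono fun k hk => hk.le
    rw [add_zero]
    exact (lt_div_iff₀ hL).1 hs_lt
  have hstep : ∀ᶠ k in atTop, ∀ u ∈ D,
      (φ + g) (x (k + 1)) + ε k / 2 * ‖x (k + 1)‖ ^ 2 + 1 / (2 * s) * ‖x (k + 1) - u‖ ^ 2 ≤
        (φ + g) u + ε k / 2 * ‖u‖ ^ 2 + 1 / (2 * s) * ‖y k - u‖ ^ 2 := by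
    filter_upwards [hsL, eventually_ge_atTop 1] with k hk hk1 u hu
    have hpD := hxD (k + 1) (by omega)
    refine prox_gradient_step hφ hg_convex hg_diff hg_lip hs_pos (hε_pos k hk1).le hk hpD hu ?_
    intro w hw
    have h := hprox s hs_pos (y k - s • g' (y k) - (s * ε k) • y k) w
    rw [← hx k hk1, hcoe _ hpD, hcoe _ hw] at h
    exact_mod_cast h
  obtain ⟨hval, hvel⟩ := inertial_rates_of_step hφg (x := x) (y := y) (b := xbar)
    (R := ‖xmin‖) (show 0 < 1 / (2 * s) by positivity) hq ht
    ((tendsto_add_atTop_nat 1).eventually hqt)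
    ((eventually_ge_atTop 1).mono hε_pos) ((eventually_ge_atTop 1).mono hε_anti)
    ((eventually_ge_atTop (k₀ - 1)).mono fun k hk => (hincr k hk).le) htε_top hratio
    ((eventually_ge_atTop 2).mono hxD) (Eventually.of_forall hbD)
    ((eventually_ge_atTop 1).mono hbR) (Eventually.of_forall hbmin)
    (Eventually.of_forall fun n => hy (n + 1) (by omega)) hstep
  refine ⟨?_, ?_, hvel⟩
  · have h1 := (continuous_coe_real_ereal.tendsto 0).comp hval
    refine h1.congr' ?_
    filter_upwards [eventually_ge_atTop 2] with k hk
    rw [hF' k _ (hxD k hk), hF' k _ (hbD k)]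
    norm_cast
  · refine ⟨1 + ‖xmin‖ ^ 2 / 2, by positivity, ?_⟩
    obtain ⟨K, hK⟩ := eventually_atTop.1 (hval.eventually (gt_mem_nhds one_pos))
    refine ⟨max K 2, fun k hk => ?_⟩
    have hk2 : 2 ≤ k := (le_max_right _ _).trans hk
    have he := hε_pos k (by omega)
    have h1 := hK k ((le_max_left _ _).trans hk)
    rw [div_lt_one he] at h1
    simp only [Pi.add_apply] at h1
    have h2 := hbmin k xmin hminD
    have h3 : 0 ≤ ε k / 2 * ‖x k‖ ^ 2 := by positivity
    have h4 : φ (x k) + g (x k) ≤ φ xmin + g xmin + (1 + ‖xmin‖ ^ 2 / 2) * ε k := by linarith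
    rw [hcoe _ (hxD k hk2), hcoe _ hminD]
    exact_mod_cast h4
end

section
/- Let (t_k)_{k≥0} satisfy condition (T), let 0 < s < 1/L, and let (x_k) be generated by (TIREPROG). Let k₀ ∈ ℕ be such that s ≤ 1/(L + ε_{k₀}), and set α_k = (−t_k² + t_k + t_{k−1}²)/t_{k−1}² and π_k = 1/∏_{i=k₀}^{k}(1 − α_i). Assume that π_k → +∞, that limsup_{k→∞} t_k²(ε_k − ε_{k+1})/α_k < +∞, and that limsup_{k→∞} t_k ε_k/α_k < +∞. Then there exist C₁, C₂ > 0 and K ∈ ℕ such that for all k ≥ K: F_k(x_k) − F_k(x̄_k) ≤ C₁/t_{k−1}², and (f+g)(x_k) − min(f+g) ≤ C₁/t_{k−1}² + C₂ ε_k. -/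
open Filter Topology
open scoped RealInnerProductSpace

section TikhonovProximalGradient

variable {H : Type*} [NormedAddCommGroup H] [InnerProductSpace ℝ H]

/-- Three-point inequality: the proximal objective grows quadratically away from its minimizer. -/
lemma three_point_of_prox_minimizer {D : Set H} {φ : H → ℝ} (hφ : ConvexOn ℝ D φ)
    {s : ℝ} {p z : H} (hp : p ∈ D)
    (hmin : ∀ u ∈ D, φ p + ‖p - z‖ ^ 2 / (2 * s) ≤ φ u + ‖u - z‖ ^ 2 / (2 * s))
    {u : H} (hu : u ∈ D) :
    φ p + ‖p - z‖ ^ 2 / (2 * s) + ‖u - p‖ ^ 2 / (2 * s) ≤ φ u + ‖u - z‖ ^ 2 / (2 * s) := by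
  have key : ∀ a : ℝ, 0 < a → a < 1 →
      φ p + ‖p - z‖ ^ 2 / (2 * s) + (1 - a) * (‖u - p‖ ^ 2 / (2 * s))
        ≤ φ u + ‖u - z‖ ^ 2 / (2 * s) := by
    intro a ha ha1
    have h1 := hmin _ (hφ.1 hp hu (sub_nonneg.2 ha1.le) ha.le (by ring))
    have h2 := hφ.2 hp hu (sub_nonneg.2 ha1.le) ha.le (by ring)
    have h3 : ‖(1 - a) • p + a • u - z‖ ^ 2
        = (1 - a) * ‖p - z‖ ^ 2 + a * ‖u - z‖ ^ 2 - a * (1 - a) * ‖u - p‖ ^ 2 := by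
      have e1 : (1 - a) • p + a • u - z = (p - z) + a • (u - p) := by module
      have e2 : u - z = (p - z) + (u - p) := by module
      rw [e1, e2, norm_add_sq_real, norm_add_sq_real, norm_smul, inner_smul_right, mul_pow,
        Real.norm_eq_abs, sq_abs]
      ring
    rw [h3] at h1
    simp only [smul_eq_mul] at h2
    have h4 : a * (φ p + ‖p - z‖ ^ 2 / (2 * s) + (1 - a) * (‖u - p‖ ^ 2 / (2 * s)))
        ≤ a * (φ u + ‖u - z‖ ^ 2 / (2 * s)) := by
      have e3 : ((1 - a) * ‖p - z‖ ^ 2 + a * ‖u - z‖ ^ 2 - a * (1 - a) * ‖u - p‖ ^ 2) / (2 * s)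
          = (1 - a) * (‖p - z‖ ^ 2 / (2 * s)) + a * (‖u - z‖ ^ 2 / (2 * s))
            - a * (1 - a) * (‖u - p‖ ^ 2 / (2 * s)) := by ring
      rw [e3] at h1
      linarith
    exact le_of_mul_le_mul_left h4 ha
  have hlim : Tendsto (fun a : ℝ => φ p + ‖p - z‖ ^ 2 / (2 * s)
      + (1 - a) * (‖u - p‖ ^ 2 / (2 * s))) (𝓝[>] 0)
      (𝓝 (φ p + ‖p - z‖ ^ 2 / (2 * s) + (1 - 0) * (‖u - p‖ ^ 2 / (2 * s)))) :=
    (Continuous.tendsto (by fun_prop) 0).mono_left nhdsWithin_le_nhds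
  rw [sub_zero, one_mul] at hlim
  refine le_of_tendsto hlim ?_
  filter_upwards [Ioo_mem_nhdsGT (zero_lt_one' ℝ)] with a ha using key a ha.1 ha.2

lemma hasDerivAt_comp_segment [CompleteSpace H] {g : H → ℝ} {g' : H → H}
    (hg : ∀ u, HasGradientAt g (g' u) u) (u d : H) (τ : ℝ) :
    HasDerivAt (fun τ : ℝ => g (u + τ • d)) ⟪g' (u + τ • d), d⟫ τ := by
  have h1 : HasDerivAt (fun τ : ℝ => u + τ • d) d τ := by
    simpa using ((hasDerivAt_id τ).smul_const d).const_add u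
  have h2 := (hg (u + τ • d)).hasFDerivAt.comp_hasDerivAt τ h1
  rw [InnerProductSpace.toDual_apply_apply] at h2
  exact h2

/-- Gradient inequality for a differentiable convex function. -/
lemma ConvexOn.add_inner_gradient_le [CompleteSpace H] {g : H → ℝ} {g' : H → H}
    (hc : ConvexOn ℝ Set.univ g) (hg : ∀ u, HasGradientAt g (g' u) u) (u v : H) :
    g u + ⟪g' u, v - u⟫ ≤ g v := by
  have hconv : ConvexOn ℝ Set.univ (fun τ : ℝ => g (u + τ • (v - u))) := by
    refine ⟨convex_univ, fun a _ b _ p q hp hq hpq => ?_⟩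
    have h := hc.2 (Set.mem_univ (u + a • (v - u))) (Set.mem_univ (u + b • (v - u))) hp hq hpq
    have e : u + (p • a + q • b) • (v - u)
        = p • (u + a • (v - u)) + q • (u + b • (v - u)) := by
      obtain rfl : q = 1 - p := by linarith
      simp only [smul_eq_mul]
      module
    simpa only [e] using h
  have h := hconv.le_slope_of_hasDerivAt (Set.mem_univ 0) (Set.mem_univ 1) one_pos
    (hasDerivAt_comp_segment hg u (v - u) 0)
  simp [slope_def_field] at h
  linarith

/-- Descent lemma for a function with Lipschitz gradient. -/
lemma descent_of_lipschitz_gradient [CompleteSpace H] {g : H → ℝ} {g' : H → H} {L : ℝ}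
    (hg : ∀ u, HasGradientAt g (g' u) u)
    (hlip : ∀ u v, ‖g' u - g' v‖ ≤ L * ‖u - v‖) (u v : H) :
    g v ≤ g u + ⟪g' u, v - u⟫ + L / 2 * ‖v - u‖ ^ 2 := by
  set d := v - u with hd
  have hder : ∀ τ : ℝ, HasDerivAt
      (fun τ : ℝ => g (u + τ • d) - τ * ⟪g' u, d⟫ - τ ^ 2 * (L / 2 * ‖d‖ ^ 2))
      (⟪g' (u + τ • d), d⟫ - ⟪g' u, d⟫ - 2 * τ * (L / 2 * ‖d‖ ^ 2)) τ := by
    intro τ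
    have h := ((hasDerivAt_comp_segment hg u d τ).sub
      ((hasDerivAt_id τ).mul_const ⟪g' u, d⟫)).sub
      ((hasDerivAt_pow 2 τ).mul_const (L / 2 * ‖d‖ ^ 2))
    refine h.congr_deriv ?_
    norm_num
  have hanti : AntitoneOn
      (fun τ : ℝ => g (u + τ • d) - τ * ⟪g' u, d⟫ - τ ^ 2 * (L / 2 * ‖d‖ ^ 2)) (Set.Ici 0) := by
    refine antitoneOn_of_deriv_nonpos (convex_Ici 0)
      (fun τ _ => (hder τ).continuousAt.continuousWithinAt)
      (fun τ _ => (hder τ).differentiableAt.differentiableWithinAt) (fun τ hτ => ?_)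
    rw [interior_Ici, Set.mem_Ioi] at hτ
    rw [(hder τ).deriv, ← inner_sub_left]
    have h1 := real_inner_le_norm (g' (u + τ • d) - g' u) d
    have h2 : ‖g' (u + τ • d) - g' u‖ ≤ L * (τ * ‖d‖) := by
      simpa [norm_smul, abs_of_pos hτ] using hlip (u + τ • d) u
    nlinarith [mul_le_mul_of_nonneg_right h2 (norm_nonneg d)]
  have h := hanti (Set.mem_Ici.2 le_rfl) (Set.mem_Ici.2 zero_le_one) zero_le_one
  simp [hd] at h
  linarith

/-- One proximal-gradient step on the Tikhonov-regularized objective. -/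
lemma prox_grad_step_le [CompleteSpace H] {D : Set H} {φ g : H → ℝ} {g' : H → H} {L s e : ℝ}
    (hφ : ConvexOn ℝ D φ) (hc : ConvexOn ℝ Set.univ g) (hg : ∀ u, HasGradientAt g (g' u) u)
    (hlip : ∀ u v, ‖g' u - g' v‖ ≤ L * ‖u - v‖) (hs : 0 < s) (he : 0 ≤ e)
    (hse : s * (L + e) ≤ 1) {p y : H} (hp : p ∈ D)
    (hmin : ∀ u ∈ D, φ p + ‖p - (y - s • g' y - (s * e) • y)‖ ^ 2 / (2 * s)
      ≤ φ u + ‖u - (y - s • g' y - (s * e) • y)‖ ^ 2 / (2 * s))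
    {u : H} (hu : u ∈ D) :
    φ p + g p + e / 2 * ‖p‖ ^ 2
      ≤ φ u + g u + e / 2 * ‖u‖ ^ 2 + (‖u - y‖ ^ 2 - ‖u - p‖ ^ 2) / (2 * s) := by
  have h1 := three_point_of_prox_minimizer hφ hp hmin hu
  have expand : ∀ q : H, ‖q - (y - s • g' y - (s * e) • y)‖ ^ 2 / (2 * s)
      = ‖q - y‖ ^ 2 / (2 * s) + ⟪g' y, q - y⟫ + e * ⟪y, q - y⟫
        + s / 2 * ‖g' y + e • y‖ ^ 2 := by
    intro q
    have e1 : q - (y - s • g' y - (s * e) • y) = (q - y) + s • (g' y + e • y) := by module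
    rw [e1, norm_add_sq_real, norm_smul, inner_smul_right, mul_pow, Real.norm_eq_abs, sq_abs,
      inner_add_right, inner_smul_right, real_inner_comm (g' y), real_inner_comm y]
    field_simp
    ring
  have sq_expand : ∀ q : H, ‖q‖ ^ 2 = ‖y‖ ^ 2 + 2 * ⟪y, q - y⟫ + ‖q - y‖ ^ 2 := by
    intro q
    rw [← norm_add_sq_real, add_sub_cancel]
  rw [expand, expand] at h1
  have h2 := descent_of_lipschitz_gradient hg hlip y p
  have h3 := hc.add_inner_gradient_le hg y u
  have h4 : (L + e) / 2 * ‖p - y‖ ^ 2 ≤ ‖p - y‖ ^ 2 / (2 * s) := by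
    rw [le_div_iff₀ (by positivity)]
    nlinarith [mul_le_mul_of_nonneg_right hse (sq_nonneg ‖p - y‖)]
  have h5 : 0 ≤ e / 2 * ‖u - y‖ ^ 2 := by positivity
  rw [sq_expand p, sq_expand u, sub_div]
  linarith

/-- Decay of the Lyapunov energy along one inertial step with a Tikhonov correction. -/
lemma energy_step {D : Set H} {Φ : H → ℝ} (hΦ : ConvexOn ℝ D Φ) {s : ℝ} (hs : 0 < s)
    {x y p w η : H} (hx : x ∈ D) (hw : w ∈ D)
    (hstep : ∀ u ∈ D, Φ p ≤ Φ u + (‖u - y‖ ^ 2 - ‖u - p‖ ^ 2) / (2 * s))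
    {T a : ℝ} (hT : 1 ≤ T) (ha0 : 0 ≤ a) (ha1 : a ≤ 1)
    (hy : T • y = (T - 1) • x + (1 - a) • η) :
    T ^ 2 * (Φ p - Φ w) + ‖w - (x + T • (p - x))‖ ^ 2 / (2 * s)
      ≤ (T ^ 2 - T) * (Φ x - Φ w)
        + (1 - a) * (‖w - η‖ ^ 2 / (2 * s)) + a * (‖w‖ ^ 2 / (2 * s)) := by
  have hT0 : 0 < T := by linarith
  have hi : 0 ≤ 1 - 1 / T := by
    rw [sub_nonneg, div_le_one hT0]; exact hT
  have hi' : 0 ≤ 1 / T := by positivity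
  set u : H := (1 - 1 / T) • x + (1 / T) • w with hu
  have h1 := hstep u (hΦ.1 hx hw hi hi' (by ring))
  have h2 := hΦ.2 hx hw hi hi' (by ring)
  rw [← hu] at h2
  simp only [smul_eq_mul] at h2
  have hTu : T • u = (T - 1) • x + w := by
    rw [hu, smul_add, smul_smul, smul_smul]
    have e1 : T * (1 - 1 / T) = T - 1 := by field_simp
    have e2 : T * (1 / T) = 1 := by field_simp
    rw [e1, e2, one_smul]
  have normT : ∀ q : H, T ^ 2 * ‖q‖ ^ 2 = ‖T • q‖ ^ 2 := by
    intro q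
    rw [norm_smul, mul_pow, Real.norm_eq_abs, sq_abs]
  have n1 : T ^ 2 * ‖u - y‖ ^ 2 = ‖w - (1 - a) • η‖ ^ 2 := by
    rw [normT, smul_sub, hTu, hy]
    congr 2
    module
  have n2 : T ^ 2 * ‖u - p‖ ^ 2 = ‖w - (x + T • (p - x))‖ ^ 2 := by
    rw [normT, smul_sub, hTu]
    congr 2
    module
  have n3 : ‖w - (1 - a) • η‖ ^ 2 ≤ (1 - a) * ‖w - η‖ ^ 2 + a * ‖w‖ ^ 2 := by
    rw [norm_sub_sq_real, norm_sub_sq_real, norm_smul, inner_smul_right, mul_pow,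
      Real.norm_eq_abs, sq_abs]
    nlinarith [mul_nonneg (mul_nonneg ha0 (sub_nonneg.2 ha1)) (sq_nonneg ‖η‖)]
  have h3 : T ^ 2 * Φ p ≤ T ^ 2 * ((1 - 1 / T) * Φ x + 1 / T * Φ w
      + (‖u - y‖ ^ 2 - ‖u - p‖ ^ 2) / (2 * s)) :=
    mul_le_mul_of_nonneg_left (by linarith) (sq_nonneg T)
  have e3 : T ^ 2 * ((1 - 1 / T) * Φ x + 1 / T * Φ w
      + (‖u - y‖ ^ 2 - ‖u - p‖ ^ 2) / (2 * s))
      = (T ^ 2 - T) * Φ x + T * Φ w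
        + (T ^ 2 * ‖u - y‖ ^ 2 - T ^ 2 * ‖u - p‖ ^ 2) / (2 * s) := by
    field_simp
  rw [e3, n1, n2] at h3
  have h4 := div_le_div_of_nonneg_right n3 (by positivity : 0 ≤ 2 * s)
  rw [add_div, mul_div_assoc, mul_div_assoc] at h4
  rw [sub_div] at h3
  linarith

lemma convexOn_const_mul_norm_sq {e : ℝ} (he : 0 ≤ e) :
    ConvexOn ℝ Set.univ (fun u : H => e * ‖u‖ ^ 2) :=
  ((convexOn_norm convex_univ).pow (fun _ _ => norm_nonneg _) 2).smul he

end TikhonovProximalGradient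

lemma convexOn_toReal_of_ereal {H : Type*} [AddCommGroup H] [Module ℝ H] {f : H → EReal}
    (hbot : ∀ z, f z ≠ ⊥)
    (hconv : ∀ u v : H, ∀ a b : ℝ, 0 ≤ a → 0 ≤ b → a + b = 1 →
      f (a • u + b • v) ≤ (a : EReal) * f u + (b : EReal) * f v) :
    ConvexOn ℝ {u | f u ≠ ⊤} (fun u => (f u).toReal) := by
  have key : ∀ u v : H, f u ≠ ⊤ → f v ≠ ⊤ → ∀ a b : ℝ, 0 ≤ a → 0 ≤ b → a + b = 1 →
      f (a • u + b • v) ≤ ((a * (f u).toReal + b * (f v).toReal : ℝ) : EReal) := by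
    intro u v hu hv a b ha hb hab
    have h := hconv u v a b ha hb hab
    rw [← EReal.coe_toReal hu (hbot u), ← EReal.coe_toReal hv (hbot v)] at h
    exact_mod_cast h
  refine ⟨fun u hu v hv a b ha hb hab => ?_, fun u hu v hv a b ha hb hab => ?_⟩
  · exact ne_top_of_le_ne_top (EReal.coe_ne_top _) (key u v hu hv a b ha hb hab)
  · have h := EReal.toReal_le_toReal (key u v hu hv a b ha hb hab) (hbot _) (EReal.coe_ne_top _)
    rwa [EReal.toReal_coe] at h

/-- A sequence whose next term is at most a convex combination of itself and `C` stays bounded. -/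
lemma le_max_of_le_convex_combination {E α : ℕ → ℝ} {C : ℝ} {N : ℕ}
    (hα0 : ∀ k ≥ N, 0 ≤ α k) (hα1 : ∀ k ≥ N, α k ≤ 1)
    (hE : ∀ k ≥ N, E (k + 1) ≤ (1 - α k) * E k + α k * C) :
    ∀ k ≥ N, E k ≤ max (E N) C := by
  intro k hk
  induction k, hk using Nat.le_induction with
  | base => exact le_max_left _ _
  | succ k hk ih =>
    have h1 := mul_le_mul_of_nonneg_left ih (sub_nonneg.2 (hα1 k hk))
    have h2 := mul_le_mul_of_nonneg_left (le_max_right (E N) C) (hα0 k hk)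
    linarith [hE k hk]

theorem tireprog_optimal_rate_pi_top
    {H : Type*} [NormedAddCommGroup H] [InnerProductSpace ℝ H] [CompleteSpace H]
    (f : H → EReal) (g : H → ℝ) (g' : H → H) (L : ℝ) (hL : 0 < L)
    -- f is proper, convex and lower semicontinuous
    (hf_proper : ∃ z, f z ≠ ⊤) (hf_nebot : ∀ z, f z ≠ ⊥)
    (hf_convex : ∀ u v : H, ∀ a b : ℝ, 0 ≤ a → 0 ≤ b → a + b = 1 →
      f (a • u + b • v) ≤ (a : EReal) * f u + (b : EReal) * f v)
    (hf_lsc : LowerSemicontinuous f)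
    -- g is convex, differentiable with L-Lipschitz gradient g'
    (hg_convex : ConvexOn ℝ Set.univ g)
    (hg_diff : ∀ u : H, HasGradientAt g (g' u) u)
    (hg_lip : ∀ u v : H, ‖g' u - g' v‖ ≤ L * ‖u - v‖)
    -- prox_{σ f} is a minimizer of u ↦ f(u) + ‖u − z‖²/(2σ)
    (prox : ℝ → H → H)
    (hprox : ∀ σ : ℝ, 0 < σ → ∀ z u : H,
      f (prox σ z) + ((‖prox σ z - z‖ ^ 2 / (2 * σ) : ℝ) : EReal)
        ≤ f u + ((‖u - z‖ ^ 2 / (2 * σ) : ℝ) : EReal))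
    -- the sequence (t_k) satisfies condition (T)
    (t : ℕ → ℝ) (ht0 : t 0 = 1)
    (hT : ∀ k : ℕ, 1 ≤ k →
      t (k - 1) < t k ∧ t k < (1 + Real.sqrt (1 + 4 * t (k - 1) ^ 2)) / 2)
    -- (ε_k) is a nonincreasing sequence of positive reals tending to 0
    (ε : ℕ → ℝ) (hε_pos : ∀ k : ℕ, 1 ≤ k → 0 < ε k)
    (hε_anti : ∀ k : ℕ, 1 ≤ k → ε (k + 1) ≤ ε k)
    (hε_lim : Tendsto ε atTop (nhds (0 : ℝ)))
    -- the stepsize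
    (s : ℝ) (hs_pos : 0 < s) (hs_lt : s < 1 / L)
    -- the algorithm (TIREPROG)
    (x y : ℕ → H)
    (hy : ∀ k : ℕ, 1 ≤ k → y k = x k
        + (((t k - 1) * (t (k - 1) - 1)) / (t (k - 1)) ^ 2) • (x k - x (k - 1))
        - (((-(t k) ^ 2 + t k + (t (k - 1)) ^ 2) / ((t (k - 1)) ^ 2 * t k))) • x k)
    (hx : ∀ k : ℕ, 1 ≤ k →
      x (k + 1) = prox s (y k - s • g' (y k) - (s * ε k) • y k))
    -- α_k and π_k
    (k₀ : ℕ) (hk₀ : s ≤ 1 / (L + ε k₀))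
    (α π : ℕ → ℝ)
    (hα : ∀ k : ℕ, 1 ≤ k → α k = (-(t k) ^ 2 + t k + (t (k - 1)) ^ 2) / (t (k - 1)) ^ 2)
    (hπ : ∀ k : ℕ, k₀ ≤ k → π k = 1 / ∏ i ∈ Finset.Icc k₀ k, (1 - α i))
    -- hypotheses (a)
    (hπ_top : Tendsto π atTop atTop)
    (hsup1 : ∃ M : ℝ, ∀ᶠ k in atTop, (t k) ^ 2 * (ε k - ε (k + 1)) / α k ≤ M)
    (hsup2 : ∃ M : ℝ, ∀ᶠ k in atTop, t k * ε k / α k ≤ M)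
    -- F_k(x) = f(x) + g(x) + (ε_k/2)‖x‖² and its unique minimizer x̄_k
    (F : ℕ → H → EReal)
    (hF : ∀ (k : ℕ) (u : H), F k u = f u + (g u : EReal) + ((ε k / 2 * ‖u‖ ^ 2 : ℝ) : EReal))
    (xbar : ℕ → H)
    (hxbar : ∀ (k : ℕ) (u : H), F k (xbar k) ≤ F k u)
    -- a (global) minimizer of f + g, so that (f+g)(xmin) = min (f+g)
    (xmin : H)
    (hxmin : ∀ u : H, f xmin + (g xmin : EReal) ≤ f u + (g u : EReal))
 :
    ∃ C₁ C₂ : ℝ, 0 < C₁ ∧ 0 < C₂ ∧ ∃ K : ℕ, ∀ k : ℕ, K ≤ k →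
      F k (x k) ≤ F k (xbar k) + ((C₁ / (t (k - 1)) ^ 2 : ℝ) : EReal) ∧
      f (x k) + (g (x k) : EReal)
        ≤ f xmin + (g xmin : EReal) + ((C₁ / (t (k - 1)) ^ 2 + C₂ * ε k : ℝ) : EReal) := by
  have ht1 : ∀ k : ℕ, 1 ≤ t k := by
    intro k
    induction k with
    | zero => exact ht0.ge
    | succ k ih => exact ih.trans (hT (k + 1) (by omega)).1.le
  have hαt : ∀ k, 1 ≤ k → (1 - α k) * t (k - 1) ^ 2 = t k ^ 2 - t k := by
    intro k hk
    have h0 := ht1 (k - 1)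
    rw [hα k hk]
    field_simp
    ring
  have hα_pos : ∀ k, 1 ≤ k → 0 < α k := by
    intro k hk
    have h0 := ht1 (k - 1)
    have h1 := ht1 k
    rw [hα k hk]
    refine div_pos ?_ (by positivity)
    have h2 : 2 * t k - 1 < Real.sqrt (1 + 4 * t (k - 1) ^ 2) := by linarith [(hT k hk).2]
    have h3 := (Real.lt_sqrt (by linarith)).1 h2
    nlinarith
  have hα_le : ∀ k, 1 ≤ k → α k ≤ 1 := by
    intro k hk
    have h0 := ht1 (k - 1)
    have h1 := ht1 k
    have h2 : 0 ≤ (1 - α k) * t (k - 1) ^ 2 := by rw [hαt k hk]; nlinarith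
    linarith [nonneg_of_mul_nonneg_left h2 (by positivity)]
  set D : Set H := {u | f u ≠ ⊤} with hD
  set φ : H → ℝ := fun u => (f u).toReal with hφ_def
  have hφ : ConvexOn ℝ D φ := convexOn_toReal_of_ereal hf_nebot hf_convex
  have hfφ : ∀ u ∈ D, f u = (φ u : EReal) := fun u hu =>
    (EReal.coe_toReal hu (hf_nebot u)).symm
  obtain ⟨z₀, hz₀⟩ := hf_proper
  have hz₀D : z₀ ∈ D := hz₀
  have hwD : xmin ∈ D := by
    intro htop
    have h := hxmin z₀
    rw [htop, hfφ z₀ hz₀D, EReal.top_add_coe, ← EReal.coe_add] at h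
    exact EReal.coe_ne_top _ (top_le_iff.1 h)
  have hxD : ∀ k, 1 ≤ k → x (k + 1) ∈ D := by
    intro k hk htop
    rw [hx k hk] at htop
    have h := hprox s hs_pos (y k - s • g' (y k) - (s * ε k) • y k) z₀
    rw [htop, hfφ z₀ hz₀D, EReal.top_add_coe, ← EReal.coe_add] at h
    exact EReal.coe_ne_top _ (top_le_iff.1 h)
  have hxbarD : ∀ k, xbar k ∈ D := by
    intro k htop
    have h := hxbar k z₀
    rw [hF, hF, htop, hfφ z₀ hz₀D, EReal.top_add_coe, EReal.top_add_coe, ← EReal.coe_add,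
      ← EReal.coe_add] at h
    exact EReal.coe_ne_top _ (top_le_iff.1 h)
  have hw_min : ∀ u ∈ D, φ xmin + g xmin ≤ φ u + g u := by
    intro u hu
    have h := hxmin u
    rw [hfφ u hu, hfφ xmin hwD] at h
    exact_mod_cast h
  set Φ : ℕ → H → ℝ := fun k u => φ u + g u + ε k / 2 * ‖u‖ ^ 2 with hΦ_def
  have hFΦ : ∀ k, ∀ u ∈ D, F k u = (Φ k u : EReal) := by
    intro k u hu
    rw [hF, hfφ u hu]
    norm_cast
  have hΦ_conv : ∀ k, 1 ≤ k → ConvexOn ℝ D (Φ k) := by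
    intro k hk
    have h1 := (convexOn_const_mul_norm_sq (H := H) (half_pos (hε_pos k hk)).le).subset
      (Set.subset_univ D) hφ.1
    exact (hφ.add (hg_convex.subset (Set.subset_univ D) hφ.1)).add h1
  obtain ⟨M₁, hM₁⟩ := hsup1
  obtain ⟨M₂, hM₂⟩ := hsup2
  have hstep_ev : ∀ᶠ k in atTop, s * (L + ε k) < 1 := by
    have h1 : Tendsto (fun k => s * (L + ε k)) atTop (𝓝 (s * (L + 0))) :=
      (hε_lim.const_add L).const_mul s
    refine h1.eventually_lt_const ?_
    rw [add_zero]
    exact (lt_div_iff₀ hL).1 hs_lt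
  obtain ⟨N, hN⟩ := eventually_atTop.1
    ((hM₁.and hM₂).and (hstep_ev.and (eventually_ge_atTop 2)))
  set w := xmin with hw
  set E : ℕ → ℝ := fun k => t (k - 1) ^ 2 * (Φ k (x k) - Φ k w)
    + ‖w - (x (k - 1) + t (k - 1) • (x k - x (k - 1)))‖ ^ 2 / (2 * s) with hE_def
  set C : ℝ := ‖w‖ ^ 2 / (2 * s) + M₁ / 2 * ‖w‖ ^ 2 with hC_def
  have hxD' : ∀ k, 2 ≤ k → x k ∈ D := by
    intro k hk
    have h := hxD (k - 1) (by omega)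
    rwa [Nat.sub_add_cancel (by omega)] at h
  have hE_rec : ∀ k ≥ N, E (k + 1) ≤ (1 - α k) * E k + α k * C := by
    intro k hk
    obtain ⟨⟨h1, -⟩, hse, hk2⟩ := hN k hk
    have hk1 : 1 ≤ k := by omega
    have hpos := hε_pos k hk1
    have htk := ht1 k
    have htk' := ht1 (k - 1)
    have hprox_step : ∀ u ∈ D,
        Φ k (x (k + 1)) ≤ Φ k u + (‖u - y k‖ ^ 2 - ‖u - x (k + 1)‖ ^ 2) / (2 * s) := by
      intro u hu
      refine prox_grad_step_le hφ hg_convex hg_diff hg_lip hs_pos hpos.le hse.le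
        (hxD k hk1) (fun v hv => ?_) hu
      have h := hprox s hs_pos (y k - s • g' (y k) - (s * ε k) • y k) v
      rw [← hx k hk1, hfφ v hv, hfφ _ (hxD k hk1)] at h
      exact_mod_cast h
    have hyk : t k • y k = (t k - 1) • x k
        + (1 - α k) • (x (k - 1) + t (k - 1) • (x k - x (k - 1))) := by
      rw [hy k hk1, hα k hk1]
      match_scalars <;> field_simp <;> ring
    have hen := energy_step (hΦ_conv k hk1) hs_pos (hxD' k hk2) hwD hprox_step htk
      (hα_pos k hk1).le (hα_le k hk1) hyk
    rw [← hαt k hk1] at hen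
    rw [div_le_iff₀ (hα_pos k hk1)] at h1
    have h2 : Φ (k + 1) (x (k + 1)) - Φ (k + 1) w
        ≤ Φ k (x (k + 1)) - Φ k w + (ε k - ε (k + 1)) / 2 * ‖w‖ ^ 2 := by
      simp only [hΦ_def]
      nlinarith [mul_nonneg (sub_nonneg.2 (hε_anti k hk1)) (sq_nonneg ‖x (k + 1)‖)]
    have h3 := mul_le_mul_of_nonneg_left h2 (sq_nonneg (t k))
    have h4 := mul_le_mul_of_nonneg_right h1 (by positivity : 0 ≤ ‖w‖ ^ 2 / 2)
    simp only [hE_def, hC_def, Nat.add_sub_cancel]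
    linarith
  have hE_bdd := le_max_of_le_convex_combination
    (fun k hk => (hα_pos k (by have := (hN k hk).2.2; omega)).le)
    (fun k hk => hα_le k (by have := (hN k hk).2.2; omega)) hE_rec
  set B : ℝ := max (E N) C
  refine ⟨|B| + |M₂| * (‖w‖ ^ 2 / 2) + 1, ‖w‖ ^ 2 / 2 + 1, by positivity, by positivity, N,
    fun k hk => ?_⟩
  obtain ⟨⟨-, h2⟩, -, hk2⟩ := hN k hk
  have hk1 : 1 ≤ k := by omega
  have hpos := hε_pos k hk1
  have htk := ht1 k
  have htk' := ht1 (k - 1)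
  have htsq : 0 < t (k - 1) ^ 2 := by positivity
  have hgap : Φ k (x k) - Φ k w ≤ |B| / t (k - 1) ^ 2 := by
    rw [le_div_iff₀ htsq]
    have h := hE_bdd k hk
    have h' : 0 ≤ ‖w - (x (k - 1) + t (k - 1) • (x k - x (k - 1)))‖ ^ 2 / (2 * s) := by positivity
    simp only [hE_def] at h
    linarith [le_abs_self B]
  have hε_le : ε k ≤ |M₂| / t (k - 1) ^ 2 := by
    rw [le_div_iff₀ htsq]
    rw [div_le_iff₀ (hα_pos k hk1)] at h2
    have h3 : α k * t (k - 1) ^ 2 ≤ t k := by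
      nlinarith [hαt k hk1, (hT k hk1).1]
    have h4 : t k * ε k ≤ |M₂| * α k :=
      h2.trans (mul_le_mul_of_nonneg_right (le_abs_self M₂) (hα_pos k hk1).le)
    have h5 : t k * (ε k * t (k - 1) ^ 2) ≤ t k * |M₂| := by
      have h6 := mul_le_mul_of_nonneg_right h4 htsq.le
      have h7 := mul_le_mul_of_nonneg_left h3 (abs_nonneg M₂)
      linarith
    exact le_of_mul_le_mul_left h5 (by linarith)
  have hsplit : (|B| + |M₂| * (‖w‖ ^ 2 / 2) + 1) / t (k - 1) ^ 2
      = |B| / t (k - 1) ^ 2 + |M₂| / t (k - 1) ^ 2 * (‖w‖ ^ 2 / 2) + 1 / t (k - 1) ^ 2 := by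
    ring
  have hone : 0 ≤ 1 / t (k - 1) ^ 2 := by positivity
  have hεw := mul_le_mul_of_nonneg_right hε_le (by positivity : 0 ≤ ‖w‖ ^ 2 / 2)
  have hxk := hxD' k hk2
  constructor
  · rw [hFΦ k _ hxk, hFΦ k _ (hxbarD k), ← EReal.coe_add, EReal.coe_le_coe_iff, hsplit]
    have h3 := hw_min _ (hxbarD k)
    have h4 : 0 ≤ ε k / 2 * ‖xbar k‖ ^ 2 := by positivity
    have h5 : Φ k w ≤ Φ k (xbar k) + ε k * (‖w‖ ^ 2 / 2) := by
      simp only [hΦ_def]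
      linarith
    linarith
  · rw [hfφ _ hxk, hfφ _ hwD, ← EReal.coe_add, ← EReal.coe_add, ← EReal.coe_add,
      EReal.coe_le_coe_iff, hsplit]
    have h4 : 0 ≤ ε k / 2 * ‖x k‖ ^ 2 := by positivity
    have h5 : 0 ≤ |M₂| / t (k - 1) ^ 2 * (‖w‖ ^ 2 / 2) := by positivity
    simp only [hΦ_def] at hgap
    linarith
end
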